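/- arXiv:2411.08589 — 3 statements merged into one kernel-verified Lean document; each statement's English description precedes it below -/
import Mathlib

section
/- Heisenberg preparation uncertainty relation: let ψ be a Schwartz function on ℝ with ∫_ℝ |ψ(x)|² dx = 1. Then the probability measures on ℝ with densities |ψ|² and |𝓕ψ|² (with respect to Lebesgue measure) have finite second moment and Δ(|ψ|²)·Δ(|𝓕ψ|²) ≥ 1/(4π). -/
open MeasureTheory
open scoped FourierTransform

/-- Mean of the probability measure on ℝ with density `h` w.r.t. Lebesgue measure. -/
noncomputable def dMean (h : ℝ → ℝ) : ℝ := ∫ x, x * h x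

/-- Variance Δ² of the probability measure on ℝ with density `h`. -/
noncomputable def dVar (h : ℝ → ℝ) : ℝ := ∫ x, (x - dMean h) ^ 2 * h x

/-- Standard deviation Δ of the probability measure on ℝ with density `h`. -/
noncomputable def dStd (h : ℝ → ℝ) : ℝ := Real.sqrt (dVar h)

/-- The Cauchy–Schwarz inequality for the `L²` pairing of Schwartz functions. -/
theorem SchwartzMap.sq_integral_inner_le (g h : SchwartzMap ℝ ℂ) :
    (∫ x, inner ℝ (g x) (h x)) ^ 2 ≤ (∫ x, ‖g x‖ ^ 2) * ∫ x, ‖h x‖ ^ 2 := by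
  have key (u v : SchwartzMap ℝ ℂ) :
      inner ℝ (u.toLp 2) (v.toLp 2) = ∫ x, inner ℝ (u x) (v x) := by
    rw [L2.inner_def]
    refine integral_congr_ae ?_
    filter_upwards [u.coeFn_toLp 2, v.coeFn_toLp 2] with x hu hv
    rw [hu, hv]
  have := real_inner_mul_inner_self_le (g.toLp 2) (h.toLp 2)
  simpa only [key, real_inner_self_eq_norm_sq, sq] using this

/-- A Schwartz function multiplied by `x - a` is again a Schwartz function. -/
theorem SchwartzMap.exists_sub_smul (f : SchwartzMap ℝ ℂ) (a : ℝ) :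
    ∃ g : SchwartzMap ℝ ℂ, ∀ x, g x = (x - a) • f x := by
  have ha : (fun x : ℝ => x - a).HasTemperateGrowth := by fun_prop
  exact ⟨SchwartzMap.smulLeftCLM ℂ (fun x : ℝ => x - a) f,
    SchwartzMap.smulLeftCLM_apply_apply ha f⟩

theorem SchwartzMap.integrable_norm_sq (f : SchwartzMap ℝ ℂ) :
    Integrable (fun x => ‖f x‖ ^ 2) :=
  (memLp_two_iff_integrable_sq_norm f.continuous.aestronglyMeasurable).1 (f.memLp 2)

theorem SchwartzMap.integrable_sq_mul_norm_sq (f : SchwartzMap ℝ ℂ) :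
    Integrable (fun x => x ^ 2 * ‖f x‖ ^ 2) := by
  obtain ⟨g, hg⟩ := f.exists_sub_smul 0
  simpa [hg, norm_smul, mul_pow] using g.integrable_norm_sq

/-- Integration by parts for `(x - a) * ‖f x‖ ^ 2`. -/
theorem SchwartzMap.two_mul_integral_inner_deriv (f g : SchwartzMap ℝ ℂ) (a : ℝ)
    (hg : ∀ x, g x = (x - a) • f x) :
    2 * ∫ x, inner ℝ (g x) (deriv f x) = -∫ x, ‖f x‖ ^ 2 := by
  have h_int (u v : SchwartzMap ℝ ℂ) : Integrable (fun x => inner ℝ (u x) (v x)) :=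
    (SchwartzMap.pairing (innerSL ℝ) u v).integrable
  have hderiv (x : ℝ) : HasDerivAt (fun x => (x - a) * ‖f x‖ ^ 2)
      (‖f x‖ ^ 2 + 2 * inner ℝ (g x) (deriv f x)) x := by
    have h := ((hasDerivAt_id x).sub_const a).mul (f.hasDerivAt x).norm_sq
    refine h.congr_deriv ?_
    simp only [hg, real_inner_smul_left, id]
    ring
  have h_int_deriv : Integrable (fun x => 2 * inner ℝ (g x) (deriv f x)) :=
    (h_int g (SchwartzMap.derivCLM ℝ ℂ f)).const_mul 2
  have hF : Integrable (fun x => (x - a) * ‖f x‖ ^ 2) := by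
    simpa only [hg, real_inner_smul_left, real_inner_self_eq_norm_sq] using h_int g f
  have h := integral_eq_zero_of_hasDerivAt_of_integrable hderiv
    (f.integrable_norm_sq.add h_int_deriv) hF
  rw [integral_add f.integrable_norm_sq h_int_deriv, integral_const_mul] at h
  linarith

/-- Heisenberg's inequality around arbitrary centers `a` and `b`, without normalization. -/
theorem SchwartzMap.sq_integral_norm_sq_le (f : SchwartzMap ℝ ℂ) (a b : ℝ) :
    (∫ x, ‖f x‖ ^ 2) ^ 2 ≤ (4 * Real.pi) ^ 2 *
      ((∫ x, (x - a) ^ 2 * ‖f x‖ ^ 2) * ∫ ξ, (ξ - b) ^ 2 * ‖𝓕 (f : ℝ → ℂ) ξ‖ ^ 2) := by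
  obtain ⟨g, hg⟩ := f.exists_sub_smul a
  set c : ℂ := 2 * Real.pi * Complex.I * b with hc
  set h : SchwartzMap ℝ ℂ := SchwartzMap.derivCLM ℂ ℂ f - c • f with hh
  have h_inner : ∫ x, inner ℝ (g x) (h x) = ∫ x, inner ℝ (g x) (deriv f x) := by
    congr 1 with x
    have : inner ℝ (f x) (c * f x) = 0 := by
      simp [hc, Complex.inner]
      ring
    rw [hg, real_inner_smul_left, real_inner_smul_left, hh, sub_apply, smul_apply,
      SchwartzMap.derivCLM_apply, smul_eq_mul, inner_sub_right, this, sub_zero]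
  have h_fourier (ξ : ℝ) : 𝓕 h ξ = (2 * Real.pi * Complex.I * (ξ - b)) * 𝓕 (f : ℝ → ℂ) ξ := by
    have h1 : 𝓕 h = 𝓕 (SchwartzMap.derivCLM ℂ ℂ f) - c • 𝓕 f := by
      rw [hh, sub_eq_add_neg, ← neg_smul, FourierTransform.fourier_add,
        FourierTransform.fourier_smul, neg_smul, ← sub_eq_add_neg]
    have h2 : 𝓕 (SchwartzMap.derivCLM ℂ ℂ f) ξ
        = (2 * Real.pi * Complex.I * ξ) • 𝓕 (f : ℝ → ℂ) ξ :=
      congrFun (Real.fourier_deriv f.integrable f.differentiable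
        (SchwartzMap.derivCLM ℂ ℂ f).integrable) ξ
    rw [h1, sub_apply, smul_apply, h2, SchwartzMap.fourier_coe, hc]
    simp only [smul_eq_mul]
    ring
  have h_norm : ∫ x, ‖h x‖ ^ 2
      = (2 * Real.pi) ^ 2 * ∫ ξ, (ξ - b) ^ 2 * ‖𝓕 (f : ℝ → ℂ) ξ‖ ^ 2 := by
    rw [← SchwartzMap.integral_norm_sq_fourier, ← integral_const_mul]
    congr 1 with ξ
    rw [h_fourier, ← Complex.ofReal_sub]
    simp only [norm_mul, Complex.norm_real, Complex.norm_I, Real.norm_eq_abs, mul_pow, sq_abs,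
      Complex.norm_ofNat]
    ring
  have g_norm : ∫ x, ‖g x‖ ^ 2 = ∫ x, (x - a) ^ 2 * ‖f x‖ ^ 2 := by
    simp [hg, norm_smul, mul_pow, -Complex.real_smul]
  have cs := SchwartzMap.sq_integral_inner_le g h
  have parts := f.two_mul_integral_inner_deriv g a hg
  rw [h_inner, g_norm, h_norm] at cs
  calc (∫ x, ‖f x‖ ^ 2) ^ 2 = 4 * (∫ x, inner ℝ (g x) (deriv f x)) ^ 2 := by
        rw [← neg_sq, ← parts]; ring
    _ ≤ _ := by linarith

/-- Heisenberg preparation uncertainty relation: for a normalized Schwartz function ψ,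
the position density |ψ|² and momentum density |𝓕ψ|² have finite second moment, and
Δ(|ψ|²)·Δ(|𝓕ψ|²) ≥ 1/(4π). -/
theorem stmt4 (ψ : SchwartzMap ℝ ℂ) (hψ : ∫ x, ‖ψ x‖ ^ 2 = 1) :
    Integrable (fun x => x ^ 2 * ‖ψ x‖ ^ 2) ∧
    Integrable (fun ξ => ξ ^ 2 * ‖𝓕 (fun x => ψ x) ξ‖ ^ 2) ∧
    dStd (fun x => ‖ψ x‖ ^ 2) * dStd (fun ξ => ‖𝓕 (fun x => ψ x) ξ‖ ^ 2) ≥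
      1 / (4 * Real.pi) := by
  refine ⟨ψ.integrable_sq_mul_norm_sq, (𝓕 ψ).integrable_sq_mul_norm_sq, ?_⟩
  have hvar : 0 ≤ dVar (fun x => ‖ψ x‖ ^ 2) := integral_nonneg fun x => by positivity
  have h := ψ.sq_integral_norm_sq_le (dMean fun x => ‖ψ x‖ ^ 2)
    (dMean fun ξ => ‖𝓕 (fun x => ψ x) ξ‖ ^ 2)
  rw [hψ, one_pow] at h
  rw [ge_iff_le, dStd, dStd, ← Real.sqrt_mul hvar]
  refine Real.le_sqrt_of_sq_le ?_
  rw [div_pow, one_pow, div_le_iff₀' (by positivity)]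
  exact h
end

section
/- Frame-relative uncertainty relation with a sharp frame (Eq. (21) of the paper, bound 1): let ψ and φ be Schwartz functions on ℝ with ∫|ψ|² = ∫|φ|² = 1. Let A be the probability density f ⋆ g with f(y) = |φ(−y)|², g(y) = |ψ(y)|², and let B be the probability density F ⋆ G with F(η) = |𝓕φ(−η)|², G(η) = |𝓕ψ(η)|² (convolutions with respect to Lebesgue measure). Then Δ(A)·Δ(B) ≥ 1/(2π). (A and B are the distributions of the frame-conditioned position and momentum of the system in state ψ relative to the frame prepared in state φ, and equally the margins of the covariant phase-space observable generated by φ in state ψ.) -/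
open MeasureTheory
open scoped FourierTransform

/-- Convolution of real functions on ℝ w.r.t. Lebesgue measure. -/
noncomputable def fConv (f g : ℝ → ℝ) : ℝ → ℝ := fun q => ∫ y, f (q - y) * g y

/-- Integrating against a convolution amounts to integrating `p (x + y)` against the product. -/
lemma integral_mul_fConv {p f g : ℝ → ℝ}
    (h : Integrable (fun z : ℝ × ℝ => p (z.1 + z.2) * (f z.1 * g z.2))) :
    ∫ x, p x * fConv f g x = ∫ z : ℝ × ℝ, p (z.1 + z.2) * (f z.1 * g z.2) := by
  have hmp : MeasurePreserving (fun z : ℝ × ℝ => (z.1 - z.2, z.2)) volume volume :=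
    measurePreserving_sub_prod (volume : Measure ℝ) (volume : Measure ℝ)
  have hemb : MeasurableEmbedding (fun z : ℝ × ℝ => (z.1 - z.2, z.2)) :=
    (MeasurableEquiv.mk ⟨fun z : ℝ × ℝ => (z.1 - z.2, z.2), fun z => (z.1 + z.2, z.2),
      fun z => by simp, fun z => by simp⟩ (by simp; fun_prop)
        (by simp; fun_prop)).measurableEmbedding
  have h' := hmp.integrable_comp_of_integrable h
  rw [← hmp.integral_comp hemb]
  simp only [Function.comp_def, sub_add_cancel] at h' ⊢
  rw [Measure.volume_eq_prod] at h' ⊢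
  rw [integral_prod _ h']
  simp only [fConv, integral_const_mul]

lemma integrable_sub_mul {f : ℝ → ℝ} (h₀ : Integrable f) (h₁ : Integrable (fun x => x * f x))
    (c : ℝ) : Integrable (fun x => (x - c) * f x) :=
  (h₁.sub (h₀.const_mul c)).congr (.of_forall fun x => by simp; ring)

lemma integrable_sub_sq_mul {f : ℝ → ℝ} (h₀ : Integrable f)
    (h₁ : Integrable (fun x => x * f x)) (h₂ : Integrable (fun x => x ^ 2 * f x)) (c : ℝ) :
    Integrable (fun x => (x - c) ^ 2 * f x) :=
  ((h₂.sub (h₁.const_mul (2 * c))).add (h₀.const_mul (c ^ 2))).congr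
    (.of_forall fun x => by simp; ring)

lemma integral_sub_dMean_mul {f : ℝ → ℝ} (h₀ : Integrable f)
    (h₁ : Integrable (fun x => x * f x)) (hf : ∫ x, f x = 1) :
    ∫ x, (x - dMean f) * f x = 0 := by
  simp_rw [sub_mul]
  rw [integral_sub h₁ (h₀.const_mul _), integral_const_mul, hf, mul_one, dMean, sub_self]

/-- The mean is additive under convolution of probability densities. -/
lemma dMean_fConv {f g : ℝ → ℝ} (hf₀ : Integrable f) (hf₁ : Integrable (fun x => x * f x))
    (hg₀ : Integrable g) (hg₁ : Integrable (fun x => x * g x))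
    (hf : ∫ x, f x = 1) (hg : ∫ x, g x = 1) :
    dMean (fConv f g) = dMean f + dMean g := by
  have e (z : ℝ × ℝ) : (z.1 + z.2) * (f z.1 * g z.2)
      = (z.1 * f z.1) * g z.2 + f z.1 * (z.2 * g z.2) := by ring
  have i₁ : Integrable (fun z : ℝ × ℝ => (z.1 * f z.1) * g z.2) := hf₁.mul_prod hg₀
  have i₂ : Integrable (fun z : ℝ × ℝ => f z.1 * (z.2 * g z.2)) := hf₀.mul_prod hg₁
  rw [dMean, integral_mul_fConv (p := fun x => x)
    ((i₁.add i₂).congr (.of_forall fun z => (e z).symm))]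
  simp_rw [e]
  rw [integral_add i₁ i₂, Measure.volume_eq_prod,
    integral_prod_mul (fun x => x * f x) g, integral_prod_mul f (fun x => x * g x), hf, hg]
  simp [dMean]

/-- The variance is additive under convolution of probability densities. -/
lemma dVar_fConv {f g : ℝ → ℝ} (hf₀ : Integrable f) (hf₁ : Integrable (fun x => x * f x))
    (hf₂ : Integrable (fun x => x ^ 2 * f x))
    (hg₀ : Integrable g) (hg₁ : Integrable (fun x => x * g x))
    (hg₂ : Integrable (fun x => x ^ 2 * g x))
    (hf : ∫ x, f x = 1) (hg : ∫ x, g x = 1) :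
    dVar (fConv f g) = dVar f + dVar g := by
  rw [dVar, dMean_fConv hf₀ hf₁ hg₀ hg₁ hf hg]
  set a := dMean f with ha
  set b := dMean g with hb
  have e (z : ℝ × ℝ) : (z.1 + z.2 - (a + b)) ^ 2 * (f z.1 * g z.2)
      = ((z.1 - a) ^ 2 * f z.1) * g z.2 + (2 * (((z.1 - a) * f z.1) * ((z.2 - b) * g z.2))
        + f z.1 * ((z.2 - b) ^ 2 * g z.2)) := by ring
  have i₁ : Integrable (fun z : ℝ × ℝ => ((z.1 - a) ^ 2 * f z.1) * g z.2) :=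
    (integrable_sub_sq_mul hf₀ hf₁ hf₂ a).mul_prod hg₀
  have i₂ : Integrable (fun z : ℝ × ℝ => 2 * (((z.1 - a) * f z.1) * ((z.2 - b) * g z.2))) :=
    ((integrable_sub_mul hf₀ hf₁ a).mul_prod (integrable_sub_mul hg₀ hg₁ b)).const_mul 2
  have i₃ : Integrable (fun z : ℝ × ℝ => f z.1 * ((z.2 - b) ^ 2 * g z.2)) :=
    hf₀.mul_prod (integrable_sub_sq_mul hg₀ hg₁ hg₂ b)
  rw [integral_mul_fConv (p := fun x => (x - (a + b)) ^ 2)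
    ((i₁.add (i₂.add i₃)).congr (.of_forall fun z => (e z).symm))]
  simp_rw [e]
  have i₄ := i₂.add i₃
  simp only [Pi.add_def] at i₄
  rw [integral_add i₁ i₄, integral_add i₂ i₃, integral_const_mul,
    Measure.volume_eq_prod, integral_prod_mul (fun x => (x - a) ^ 2 * f x) g,
    integral_prod_mul f (fun x => (x - b) ^ 2 * g x),
    integral_prod_mul (fun x => (x - a) * f x) (fun x => (x - b) * g x), hf, hg,
    ha, integral_sub_dMean_mul hf₀ hf₁ hf]
  simp [dVar, hb]

lemma dVar_comp_neg (f : ℝ → ℝ) : dVar (fun x => f (-x)) = dVar f := by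
  have hm : dMean (fun x => f (-x)) = -dMean f := by
    rw [dMean, dMean, ← integral_neg, ← integral_neg_eq_self]
    simp
  rw [dVar, dVar, hm, ← integral_neg_eq_self]
  refine integral_congr_ae (.of_forall fun x => ?_)
  simp only [neg_neg]
  ring

lemma dVar_nonneg {f : ℝ → ℝ} (hf : ∀ x, 0 ≤ f x) : 0 ≤ dVar f :=
  integral_nonneg fun x => mul_nonneg (sq_nonneg _) (hf x)

namespace SchwartzMap

lemma integrable_pow_mul_inner (u v : SchwartzMap ℝ ℂ) (n : ℕ) :
    Integrable (fun x => x ^ n * inner ℝ (u x) (v x)) := by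
  obtain ⟨C, hC⟩ := v.decay 0 0
  refine ((u.integrable_pow_mul volume n).mul_const C).mono'
    (((continuous_id.pow n).mul (u.continuous.inner v.continuous)).aestronglyMeasurable)
    (.of_forall fun x => ?_)
  have hv : ‖v x‖ ≤ C := by simpa using hC.2 x
  rw [norm_mul, norm_pow, mul_assoc]
  gcongr
  exact (norm_inner_le_norm _ _).trans (by gcongr)

lemma integrable_pow_mul_norm_sq (u : SchwartzMap ℝ ℂ) (n : ℕ) :
    Integrable (fun x => x ^ n * ‖u x‖ ^ 2) := by
  simpa only [real_inner_self_eq_norm_sq] using u.integrable_pow_mul_inner u n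

lemma integrable_norm_sq_s12 (u : SchwartzMap ℝ ℂ) : Integrable (fun x => ‖u x‖ ^ 2) := by
  simpa using u.integrable_pow_mul_norm_sq 0

lemma integrable_mul_norm_sq (u : SchwartzMap ℝ ℂ) : Integrable (fun x => x * ‖u x‖ ^ 2) := by
  simpa using u.integrable_pow_mul_norm_sq 1

lemma integrable_sub_mul_inner (u v : SchwartzMap ℝ ℂ) (m : ℝ) :
    Integrable (fun x => (x - m) * inner ℝ (u x) (v x)) :=
  integrable_sub_mul (by simpa using u.integrable_pow_mul_inner v 0)
    (by simpa using u.integrable_pow_mul_inner v 1) m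

lemma integral_sub_mul_inner_deriv (u : SchwartzMap ℝ ℂ) (m : ℝ) :
    ∫ x, (x - m) * inner ℝ (u x) (derivCLM ℂ ℂ u x) = -(∫ x, ‖u x‖ ^ 2) / 2 := by
  have hd (x : ℝ) : HasDerivAt (fun x => (x - m) * ‖u x‖ ^ 2)
      (‖u x‖ ^ 2 + 2 * ((x - m) * inner ℝ (u x) (derivCLM ℂ ℂ u x))) x := by
    have h := ((hasDerivAt_id x).sub_const m).mul (u.differentiableAt.hasDerivAt (x := x)).norm_sq
    refine h.congr_deriv ?_
    simp [derivCLM_apply]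
    ring
  have i := (u.integrable_sub_mul_inner (derivCLM ℂ ℂ u) m).const_mul 2
  have h := integral_eq_zero_of_hasDerivAt_of_integrable hd (u.integrable_norm_sq_s12.add i)
    (integrable_sub_mul u.integrable_norm_sq_s12 u.integrable_mul_norm_sq m)
  rw [integral_add u.integrable_norm_sq_s12 i, integral_const_mul] at h
  linarith

/-- Heisenberg's inequality about arbitrary centres `m` and `k`. -/
theorem norm_sq_sq_le_integral_mul_integral_fourier (u : SchwartzMap ℝ ℂ) (m k : ℝ) :
    (∫ x, ‖u x‖ ^ 2) ^ 2 ≤ 16 * Real.pi ^ 2 *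
      ((∫ x, (x - m) ^ 2 * ‖u x‖ ^ 2) * ∫ ξ, (ξ - k) ^ 2 * ‖𝓕 u ξ‖ ^ 2) := by
  set c : ℂ := 2 * Real.pi * Complex.I * k with hc
  set v : SchwartzMap ℝ ℂ := derivCLM ℂ ℂ u - c • u with hv
  have hvu (x : ℝ) : inner ℝ (u x) (v x) = inner ℝ (u x) (derivCLM ℂ ℂ u x) := by
    simp [hv, hc, Complex.inner, inner_sub_right]
    ring
  have hF (ξ : ℝ) : 𝓕 v ξ = 2 * Real.pi * Complex.I * (ξ - k) * 𝓕 u ξ := by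
    have hd : 𝓕 (derivCLM ℂ ℂ u) ξ = 2 * Real.pi * Complex.I * ξ * 𝓕 u ξ := by
      have h := congrFun (Real.fourier_deriv u.integrable u.differentiable
        (derivCLM ℂ ℂ u).integrable) ξ
      simpa [fourier_coe] using! h
    rw [hv, sub_eq_add_neg, ← neg_smul, FourierTransform.fourier_add,
      FourierTransform.fourier_smul, add_apply, smul_apply, hd, hc, smul_eq_mul]
    ring
  have hW : ∫ x, ‖v x‖ ^ 2 = 4 * Real.pi ^ 2 * ∫ ξ, (ξ - k) ^ 2 * ‖𝓕 u ξ‖ ^ 2 := by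
    rw [← integral_norm_sq_fourier, ← integral_const_mul]
    refine integral_congr_ae (.of_forall fun ξ => ?_)
    have : ‖(ξ : ℂ) - k‖ ^ 2 = (ξ - k) ^ 2 := by
      rw [← Complex.ofReal_sub, Complex.norm_real, Real.norm_eq_abs, sq_abs]
    simp only [hF, norm_mul, mul_pow, this, Complex.norm_I, Complex.norm_real, Real.norm_eq_abs,
      sq_abs, Complex.norm_ofNat]
    ring
  have i₁ := integrable_sub_sq_mul u.integrable_norm_sq_s12 u.integrable_mul_norm_sq
    (u.integrable_pow_mul_norm_sq 2) m
  have i₂ := u.integrable_sub_mul_inner v m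
  have key (t : ℝ) : 0 ≤ (∫ x, (x - m) ^ 2 * ‖u x‖ ^ 2) * (t * t) +
      (-∫ x, ‖u x‖ ^ 2) * t + ∫ x, ‖v x‖ ^ 2 := by
    have h : 0 ≤ ∫ x, ‖(t * (x - m)) • u x + v x‖ ^ 2 := integral_nonneg fun x => sq_nonneg _
    have e (x : ℝ) : ‖(t * (x - m)) • u x + v x‖ ^ 2 = t ^ 2 * ((x - m) ^ 2 * ‖u x‖ ^ 2) +
        ((2 * t) * ((x - m) * inner ℝ (u x) (v x)) + ‖v x‖ ^ 2) := by
      rw [norm_add_sq_real, norm_smul, real_inner_smul_left, mul_pow, Real.norm_eq_abs, sq_abs]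
      ring
    simp_rw [e] at h
    have i₃ := (i₂.const_mul (2 * t)).add v.integrable_norm_sq_s12
    simp only [Pi.add_def] at i₃
    rw [integral_add (i₁.const_mul _) i₃, integral_add (i₂.const_mul _) v.integrable_norm_sq_s12,
      integral_const_mul, integral_const_mul] at h
    simp_rw [hvu] at h
    rw [integral_sub_mul_inner_deriv] at h
    linarith
  have hdisc := discrim_le_zero key
  rw [discrim, hW] at hdisc
  linarith

/-- Heisenberg's inequality for the variances of the position and momentum densities. -/
theorem one_le_dVar_mul_dVar_fourier (u : SchwartzMap ℝ ℂ) (hu : ∫ x, ‖u x‖ ^ 2 = 1) :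
    1 ≤ 16 * Real.pi ^ 2 * (dVar (fun x => ‖u x‖ ^ 2) * dVar (fun ξ => ‖𝓕 u ξ‖ ^ 2)) := by
  simpa [hu, dVar] using u.norm_sq_sq_le_integral_mul_integral_fourier
    (dMean fun x => ‖u x‖ ^ 2) (dMean fun ξ => ‖𝓕 u ξ‖ ^ 2)

lemma dVar_fConv_norm_sq (u v : SchwartzMap ℝ ℂ) (hu : ∫ x, ‖u x‖ ^ 2 = 1)
    (hv : ∫ x, ‖v x‖ ^ 2 = 1) :
    dVar (fConv (fun y => ‖u (-y)‖ ^ 2) (fun y => ‖v y‖ ^ 2)) =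
      dVar (fun x => ‖u x‖ ^ 2) + dVar (fun x => ‖v x‖ ^ 2) := by
  rw [dVar_fConv u.integrable_norm_sq_s12.comp_neg
    (by simpa using u.integrable_mul_norm_sq.comp_neg.neg)
    (by simpa using (u.integrable_pow_mul_norm_sq 2).comp_neg)
    v.integrable_norm_sq_s12 v.integrable_mul_norm_sq (v.integrable_pow_mul_norm_sq 2)
    (by rw [integral_neg_eq_self (fun x => ‖u x‖ ^ 2), hu]) hv,
    dVar_comp_neg (fun x => ‖u x‖ ^ 2)]

end SchwartzMap

/-- Frame-relative uncertainty relation with a sharp frame (Eq. (21), bound 1):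
the frame-conditioned position distribution A = |φ(−·)|² ⋆ |ψ|² and momentum
distribution B = |𝓕φ(−·)|² ⋆ |𝓕ψ|² satisfy Δ(A)·Δ(B) ≥ 1/(2π). -/
theorem stmt12 (ψ φ : SchwartzMap ℝ ℂ)
    (hψ : ∫ x, ‖ψ x‖ ^ 2 = 1) (hφ : ∫ x, ‖φ x‖ ^ 2 = 1) :
    dStd (fConv (fun y => ‖φ (-y)‖ ^ 2) (fun y => ‖ψ y‖ ^ 2)) *
      dStd (fConv (fun η => ‖𝓕 (fun x => φ x) (-η)‖ ^ 2)
        (fun η => ‖𝓕 (fun x => ψ x) η‖ ^ 2)) ≥ 1 / (2 * Real.pi) := by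
  have hψ' : ∫ ξ, ‖𝓕 ψ ξ‖ ^ 2 = 1 := by rw [SchwartzMap.integral_norm_sq_fourier, hψ]
  have hφ' : ∫ ξ, ‖𝓕 φ ξ‖ ^ 2 = 1 := by rw [SchwartzMap.integral_norm_sq_fourier, hφ]
  change 1 / (2 * Real.pi) ≤ dStd (fConv (fun y => ‖φ (-y)‖ ^ 2) (fun y => ‖ψ y‖ ^ 2)) *
    dStd (fConv (fun η => ‖𝓕 φ (-η)‖ ^ 2) (fun η => ‖𝓕 ψ η‖ ^ 2))
  have h₁ := ψ.one_le_dVar_mul_dVar_fourier hψ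
  have h₂ := φ.one_le_dVar_mul_dVar_fourier hφ
  rw [dStd, dStd, φ.dVar_fConv_norm_sq ψ hφ hψ,
    SchwartzMap.dVar_fConv_norm_sq (𝓕 φ) (𝓕 ψ) hφ' hψ']
  have ha : 0 ≤ dVar fun x => ‖φ x‖ ^ 2 := dVar_nonneg fun x => sq_nonneg _
  have hb : 0 ≤ dVar fun x => ‖ψ x‖ ^ 2 := dVar_nonneg fun x => sq_nonneg _
  have hc : 0 ≤ dVar fun x => ‖𝓕 φ x‖ ^ 2 := dVar_nonneg fun x => sq_nonneg _
  have hd : 0 ≤ dVar fun x => ‖𝓕 ψ x‖ ^ 2 := dVar_nonneg fun x => sq_nonneg _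
  set a := dVar fun x => ‖φ x‖ ^ 2
  set b := dVar fun x => ‖ψ x‖ ^ 2
  set c := dVar fun x => ‖𝓕 φ x‖ ^ 2
  set d := dVar fun x => ‖𝓕 ψ x‖ ^ 2
  rw [← Real.sqrt_mul (add_nonneg ha hb)]
  have cs : √(a * c) + √(b * d) ≤ √((a + b) * (c + d)) := by
    apply Real.le_sqrt_of_sq_le
    have h₃ : √(a * c) * √(b * d) = √(a * d) * √(b * c) := by
      rw [← Real.sqrt_mul (mul_nonneg ha hc), ← Real.sqrt_mul (mul_nonneg ha hd)]
      congr 1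
      ring
    nlinarith [Real.sq_sqrt (mul_nonneg ha hc), Real.sq_sqrt (mul_nonneg hb hd),
      Real.sq_sqrt (mul_nonneg ha hd), Real.sq_sqrt (mul_nonneg hb hc),
      sq_nonneg (√(a * d) - √(b * c))]
  have heis {s : ℝ} (h : 1 ≤ 16 * Real.pi ^ 2 * s) : 1 / (4 * Real.pi) ≤ √s := by
    apply Real.le_sqrt_of_sq_le
    rw [div_pow, one_pow, div_le_iff₀ (by positivity)]
    linarith
  have : 1 / (2 * Real.pi) = 1 / (4 * Real.pi) + 1 / (4 * Real.pi) := by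
    field_simp
    norm_num
  linarith [heis h₁, heis h₂]
end

section
/- Frame-relative uncertainty relation for sharp system observables relative to a phase-space frame (Eq. (17) of the paper, bound 3/2): let ψ, φ, χ be Schwartz functions on ℝ, each with unit L² norm. Let A = |χ|² ⋆ |φ|² ⋆ |ψ|² and B = |𝓕χ|² ⋆ |𝓕φ|² ⋆ |𝓕ψ|² (convolutions of functions with respect to Lebesgue measure; reflections of the densities do not change standard deviations). Then Δ(A)·Δ(B) ≥ 3/(4π). (A and B are, up to reflection, the distributions of the frame-conditioned sharp position and momentum of the system in state ψ, relative to a covariant phase-space frame generated by χ and prepared in state φ.) -/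
open MeasureTheory
open scoped FourierTransform

/-- `h` has total integral one and integrable moments up to order two. -/
structure HasSecondMoment (h : ℝ → ℝ) : Prop where
  integrable : Integrable h
  integrable_mul : Integrable fun x => x * h x
  integrable_sq_mul : Integrable fun x => x ^ 2 * h x
  integral_eq_one : ∫ x, h x = 1

lemma HasSecondMoment.dVar_eq {h : ℝ → ℝ} (H : HasSecondMoment h) :
    dVar h = (∫ x, x ^ 2 * h x) - dMean h ^ 2 := by
  have e : ∀ x, (x - dMean h) ^ 2 * h x
      = x ^ 2 * h x - 2 * dMean h * (x * h x) + dMean h ^ 2 * h x := fun x => by ring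
  unfold dVar
  simp_rw [e]
  have i1 := H.integrable_mul.const_mul (2 * dMean h)
  have i2 : Integrable fun x => x ^ 2 * h x - 2 * dMean h * (x * h x) :=
    H.integrable_sq_mul.sub i1
  rw [integral_add i2 (H.integrable.const_mul _), integral_sub H.integrable_sq_mul i1,
    integral_const_mul, integral_const_mul, H.integral_eq_one]
  have : ∫ x, x * h x = dMean h := rfl
  rw [this]
  ring

lemma integrable_integral_shear {G : ℝ × ℝ → ℝ} (hG : Integrable G (volume.prod volume)) :
    Integrable fun q : ℝ => ∫ y : ℝ, G (q - y, y) := by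
  have hmp := measurePreserving_sub_prod (volume : Measure ℝ) (volume : Measure ℝ)
  exact (hmp.integrable_comp_of_integrable hG).integral_prod_left

lemma integral_integral_shear {G : ℝ × ℝ → ℝ} (hG : Integrable G (volume.prod volume)) :
    ∫ q : ℝ, ∫ y : ℝ, G (q - y, y) = ∫ z, G z ∂(volume.prod volume) := by
  have hmp := measurePreserving_sub_prod (volume : Measure ℝ) (volume : Measure ℝ)
  have h1 := hmp.integrable_comp_of_integrable hG
  rw [← integral_prod (fun z : ℝ × ℝ => G (z.1 - z.2, z.2)) h1]
  have h2 := integral_map hmp.measurable.aemeasurable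
    (f := G) (by rw [hmp.map_eq]; exact hG.aestronglyMeasurable)
  rw [hmp.map_eq] at h2
  exact h2.symm

section Convolution

variable {f g : ℝ → ℝ}

lemma HasSecondMoment.fConv (hf : HasSecondMoment f) (hg : HasSecondMoment g) :
    HasSecondMoment (fConv f g) ∧ dVar (fConv f g) = dVar f + dVar g := by
  have i00 := hf.integrable.mul_prod hg.integrable
  have i10 := hf.integrable_mul.mul_prod hg.integrable
  have i01 := hf.integrable.mul_prod hg.integrable_mul
  have i11 := hf.integrable_mul.mul_prod hg.integrable_mul
  have i20 := hf.integrable_sq_mul.mul_prod hg.integrable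
  have i02 := hf.integrable.mul_prod hg.integrable_sq_mul
  have j1 := i10.add i01
  have j2 := (i20.add (i11.const_mul 2)).add i02
  have e1 : (fun q => q * _root_.fConv f g q) = fun q => ∫ y,
      ((fun z : ℝ × ℝ => z.1 * f z.1 * g z.2) + fun z : ℝ × ℝ => f z.1 * (z.2 * g z.2))
        (q - y, y) := by
    ext q
    rw [_root_.fConv, ← integral_const_mul]
    congr 1
    ext y
    simp only [Pi.add_apply]
    ring
  have e2 : (fun q => q ^ 2 * _root_.fConv f g q) = fun q => ∫ y,
      (((fun z : ℝ × ℝ => z.1 ^ 2 * f z.1 * g z.2) +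
        fun z : ℝ × ℝ => 2 * (z.1 * f z.1 * (z.2 * g z.2))) +
        fun z : ℝ × ℝ => f z.1 * (z.2 ^ 2 * g z.2)) (q - y, y) := by
    ext q
    rw [_root_.fConv, ← integral_const_mul]
    congr 1
    ext y
    simp only [Pi.add_apply]
    ring
  have m1 : dMean (_root_.fConv f g) = dMean f + dMean g := by
    rw [dMean, e1, integral_integral_shear j1, integral_add' i10 i01,
      integral_prod_mul (fun x => x * f x) g, integral_prod_mul f (fun x => x * g x),
      hf.integral_eq_one, hg.integral_eq_one, mul_one, one_mul]
    rfl
  have m2 : ∫ q, q ^ 2 * _root_.fConv f g q =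
      (∫ x, x ^ 2 * f x) + 2 * (dMean f * dMean g) + ∫ x, x ^ 2 * g x := by
    rw [e2, integral_integral_shear j2, integral_add' (i20.add (i11.const_mul 2)) i02,
      integral_add' i20 (i11.const_mul 2), integral_const_mul,
      integral_prod_mul (fun x => x ^ 2 * f x) g,
      integral_prod_mul f (fun x => x ^ 2 * g x),
      integral_prod_mul (fun x => x * f x) (fun x => x * g x),
      hf.integral_eq_one, hg.integral_eq_one, mul_one, one_mul]
    rfl
  have H : HasSecondMoment (_root_.fConv f g) := by
    refine ⟨integrable_integral_shear i00, e1 ▸ integrable_integral_shear j1,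
      e2 ▸ integrable_integral_shear j2, ?_⟩
    rw [show (∫ x, _root_.fConv f g x) = _ from integral_integral_shear i00,
      integral_prod_mul f g, hf.integral_eq_one, hg.integral_eq_one, mul_one]
  refine ⟨H, ?_⟩
  rw [H.dVar_eq, hf.dVar_eq, hg.dVar_eq, m1, m2]
  ring

end Convolution

lemma SchwartzMap.integrable_pow_mul_norm_sq_s13 (f : SchwartzMap ℝ ℂ) (k : ℕ) :
    Integrable fun x : ℝ => x ^ k * ‖f x‖ ^ 2 := by
  obtain ⟨C, hC⟩ : ∃ C, ∀ x, ‖f x‖ ≤ C :=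
    ⟨_, f.toBoundedContinuousFunction.norm_coe_le_norm⟩
  refine ((f.integrable_pow_mul volume k).const_mul C).mono'
    ((continuous_id.pow k).mul (f.continuous.norm.pow 2)).aestronglyMeasurable (.of_forall ?_)
  intro x
  rw [norm_mul, norm_pow, norm_pow, norm_norm, sq]
  have := mul_le_mul_of_nonneg_left (hC x) (by positivity : 0 ≤ ‖x‖ ^ k * ‖f x‖)
  linarith

lemma SchwartzMap.hasSecondMoment (f : SchwartzMap ℝ ℂ) (hf : ∫ x, ‖f x‖ ^ 2 = 1) :
    HasSecondMoment fun x => ‖f x‖ ^ 2 :=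
  ⟨by simpa using f.integrable_pow_mul_norm_sq_s13 0, by simpa using f.integrable_pow_mul_norm_sq_s13 1,
    f.integrable_pow_mul_norm_sq_s13 2, hf⟩

/-- The modulated derivative `f' - 2πiμ f`, whose Fourier transform is `2πi(ξ - μ) 𝓕 f(ξ)`. -/
noncomputable def SchwartzMap.modulatedDeriv (f : SchwartzMap ℝ ℂ) (μ : ℝ) : SchwartzMap ℝ ℂ :=
  SchwartzMap.derivCLM ℂ ℂ f + (-(2 * Real.pi * Complex.I * μ) : ℂ) • f

lemma SchwartzMap.modulatedDeriv_apply (f : SchwartzMap ℝ ℂ) (μ x : ℝ) :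
    f.modulatedDeriv μ x = deriv f x - 2 * Real.pi * Complex.I * μ * f x := by
  simp [modulatedDeriv, sub_eq_add_neg]

lemma SchwartzMap.fourier_modulatedDeriv (f : SchwartzMap ℝ ℂ) (μ ξ : ℝ) :
    𝓕 (f.modulatedDeriv μ) ξ = 2 * Real.pi * Complex.I * (ξ - μ) * 𝓕 f ξ := by
  have h : 𝓕 (SchwartzMap.derivCLM ℂ ℂ f) ξ = 2 * Real.pi * Complex.I * ξ * 𝓕 f ξ := by
    have := congrFun (Real.fourier_deriv f.integrable f.differentiable
      (SchwartzMap.derivCLM ℂ ℂ f).integrable) ξ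
    rw [SchwartzMap.fourier_coe, SchwartzMap.fourier_coe]
    exact this
  rw [modulatedDeriv, FourierTransform.fourier_add, FourierTransform.fourier_smul,
    add_apply, smul_apply, h, smul_eq_mul]
  ring

lemma SchwartzMap.integral_norm_sq_modulatedDeriv (f : SchwartzMap ℝ ℂ) (μ : ℝ) :
    ∫ x, ‖f.modulatedDeriv μ x‖ ^ 2
      = 4 * Real.pi ^ 2 * ∫ ξ, (ξ - μ) ^ 2 * ‖𝓕 f ξ‖ ^ 2 := by
  rw [← SchwartzMap.integral_norm_sq_fourier, ← integral_const_mul]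
  congr 1
  ext ξ
  have h : ‖((ξ : ℂ) - μ)‖ = |ξ - μ| := by
    rw [← Complex.ofReal_sub, Complex.norm_real, Real.norm_eq_abs]
  rw [fourier_modulatedDeriv]
  simp only [norm_mul, h, Complex.norm_I, Complex.norm_real, Complex.norm_two, mul_pow, sq_abs,
    Real.norm_eq_abs]
  ring

lemma SchwartzMap.hasDerivAt_norm_sq (f : SchwartzMap ℝ ℂ) (μ x : ℝ) :
    HasDerivAt (fun x => ‖f x‖ ^ 2) (2 * inner ℝ (f x) (f.modulatedDeriv μ x)) x := by
  have h := (f.hasDerivAt x).norm_sq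
  convert h using 2
  rw [modulatedDeriv_apply]
  simp only [Complex.inner, Complex.sub_re, Complex.mul_re, Complex.conj_re,
    Complex.conj_im, Complex.mul_im, Complex.sub_im, Complex.I_re, Complex.I_im, Complex.ofReal_re,
    Complex.ofReal_im, Complex.re_ofNat, Complex.im_ofNat]
  ring

/-- Heisenberg's inequality about arbitrary reference points. -/
lemma SchwartzMap.heisenberg (f : SchwartzMap ℝ ℂ) (hf : ∫ x, ‖f x‖ ^ 2 = 1) (m μ : ℝ) :
    (1 / (4 * Real.pi)) ^ 2 ≤
      (∫ x, (x - m) ^ 2 * ‖f x‖ ^ 2) * ∫ ξ, (ξ - μ) ^ 2 * ‖𝓕 f ξ‖ ^ 2 := by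
  set g := f.modulatedDeriv μ with hg
  have i0 : Integrable fun x => ‖f x‖ ^ 2 := by simpa using f.integrable_pow_mul_norm_sq_s13 0
  have i1 : Integrable fun x : ℝ => x * ‖f x‖ ^ 2 := by
    simpa using f.integrable_pow_mul_norm_sq_s13 1
  have i2 := f.integrable_pow_mul_norm_sq_s13 2
  have ig : Integrable fun x => ‖g x‖ ^ 2 := by simpa using g.integrable_pow_mul_norm_sq_s13 0
  have iu : Integrable fun x => (x - m) * ‖f x‖ ^ 2 := by
    refine (i1.sub (i0.const_mul m)).congr (.of_forall fun x => ?_)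
    simp only [Pi.sub_apply]
    ring
  have iv : Integrable fun x => (x - m) ^ 2 * ‖f x‖ ^ 2 := by
    refine ((i2.sub (i1.const_mul (2 * m))).add (i0.const_mul (m ^ 2))).congr
      (.of_forall fun x => ?_)
    simp only [Pi.sub_apply, Pi.add_apply]
    ring
  have ic : Integrable fun x => 2 * ((x - m) * inner ℝ (f x) (g x)) := by
    refine (iv.add ig).mono' ?_ (.of_forall fun x => ?_)
    · exact (continuous_const.mul ((continuous_id.sub continuous_const).mul
        (f.continuous.inner g.continuous))).aestronglyMeasurable
    · simp only [Pi.add_apply, norm_mul, Real.norm_eq_abs, abs_two]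
      have h1 := abs_real_inner_le_norm (f x) (g x)
      have h2 := mul_le_mul_of_nonneg_left h1 (abs_nonneg (x - m))
      have h3 := sq_nonneg (|x - m| * ‖f x‖ - ‖g x‖)
      have h4 := sq_abs (x - m)
      rw [← h4]
      nlinarith
  have hc : ∫ x, 2 * ((x - m) * inner ℝ (f x) (g x)) = -1 := by
    have hd : ∀ x, HasDerivAt (fun x => (x - m) * ‖f x‖ ^ 2)
        (‖f x‖ ^ 2 + 2 * ((x - m) * inner ℝ (f x) (g x))) x := by
      intro x
      refine (((hasDerivAt_id x).sub_const m).mul (f.hasDerivAt_norm_sq μ x)).congr_deriv ?_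
      rw [← hg, id]
      ring
    have key := integral_eq_zero_of_hasDerivAt_of_integrable hd (i0.add ic) iu
    rw [integral_add i0 ic, hf] at key
    linarith
  have hq : ∀ t : ℝ, 0 ≤ (∫ x, (x - m) ^ 2 * ‖f x‖ ^ 2) * (t * t) + (-1) * t
      + ∫ x, ‖g x‖ ^ 2 := by
    intro t
    have h : ∀ x, ‖(t * (x - m)) • f x + g x‖ ^ 2 = (t * t) * ((x - m) ^ 2 * ‖f x‖ ^ 2)
        + t * (2 * ((x - m) * inner ℝ (f x) (g x))) + ‖g x‖ ^ 2 := by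
      intro x
      rw [norm_add_sq_real, norm_smul, inner_smul_left, mul_pow, Real.norm_eq_abs, sq_abs]
      simp only [conj_trivial]
      ring
    have h0 : 0 ≤ ∫ x, ‖(t * (x - m)) • f x + g x‖ ^ 2 :=
      integral_nonneg fun x => by positivity
    simp_rw [h] at h0
    have iv' := iv.const_mul (t * t)
    have ic' := ic.const_mul t
    have ivc : Integrable fun x => t * t * ((x - m) ^ 2 * ‖f x‖ ^ 2)
        + t * (2 * ((x - m) * inner ℝ (f x) (g x))) := iv'.add ic'
    rw [integral_add ivc ig, integral_add iv' ic', integral_const_mul, integral_const_mul,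
      hc] at h0
    linarith
  have hd := discrim_le_zero hq
  rw [discrim, hg, f.integral_norm_sq_modulatedDeriv] at hd
  rw [div_pow, one_pow, div_le_iff₀ (by positivity)]
  nlinarith

lemma SchwartzMap.dVar_mul_dVar_fourier_ge (f : SchwartzMap ℝ ℂ) (hf : ∫ x, ‖f x‖ ^ 2 = 1) :
    (1 / (4 * Real.pi)) ^ 2 ≤ dVar (fun x => ‖f x‖ ^ 2) * dVar (fun ξ => ‖𝓕 f ξ‖ ^ 2) :=
  f.heisenberg hf _ _

lemma dVar_norm_sq_nonneg (f : ℝ → ℂ) : 0 ≤ dVar fun x => ‖f x‖ ^ 2 :=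
  integral_nonneg fun x => by positivity

lemma two_mul_sq_le_mul_add_mul {a b a₂ b₂ c : ℝ} (ha : 0 ≤ a) (hb : 0 ≤ b) (ha₂ : 0 ≤ a₂)
    (hb₂ : 0 ≤ b₂) (h : c ^ 2 ≤ a * b) (h₂ : c ^ 2 ≤ a₂ * b₂) :
    2 * c ^ 2 ≤ a * b₂ + a₂ * b := by
  have h1 : c ^ 2 * c ^ 2 ≤ (a * b) * (a₂ * b₂) := mul_le_mul h h₂ (sq_nonneg c) (by positivity)
  refine le_of_sq_le_sq ?_ (by positivity)
  nlinarith [sq_nonneg (a * b₂ - a₂ * b)]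

/-- Frame-relative uncertainty relation for sharp system observables relative to a
phase-space frame (Eq. (17), bound 3/2): with A = |χ|² ⋆ |φ|² ⋆ |ψ|² and
B = |𝓕χ|² ⋆ |𝓕φ|² ⋆ |𝓕ψ|², one has Δ(A)·Δ(B) ≥ 3/(4π). -/
theorem stmt13 (ψ φ χ : SchwartzMap ℝ ℂ)
    (hψ : ∫ x, ‖ψ x‖ ^ 2 = 1) (hφ : ∫ x, ‖φ x‖ ^ 2 = 1) (hχ : ∫ x, ‖χ x‖ ^ 2 = 1) :
    dStd (fConv (fun y => ‖χ y‖ ^ 2) (fConv (fun y => ‖φ y‖ ^ 2) (fun y => ‖ψ y‖ ^ 2))) *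
      dStd (fConv (fun η => ‖𝓕 (fun x => χ x) η‖ ^ 2)
        (fConv (fun η => ‖𝓕 (fun x => φ x) η‖ ^ 2) (fun η => ‖𝓕 (fun x => ψ x) η‖ ^ 2))) ≥
      3 / (4 * Real.pi) := by
  have eχ : (fun η => ‖𝓕 (fun x => χ x) η‖ ^ 2) = fun η => ‖𝓕 χ η‖ ^ 2 := by
    simp only [SchwartzMap.fourier_coe]
  have eφ : (fun η => ‖𝓕 (fun x => φ x) η‖ ^ 2) = fun η => ‖𝓕 φ η‖ ^ 2 := by
    simp only [SchwartzMap.fourier_coe]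
  have eψ : (fun η => ‖𝓕 (fun x => ψ x) η‖ ^ 2) = fun η => ‖𝓕 ψ η‖ ^ 2 := by
    simp only [SchwartzMap.fourier_coe]
  rw [eχ, eφ, eψ]
  have A := (φ.hasSecondMoment hφ).fConv (ψ.hasSecondMoment hψ)
  have A' := (χ.hasSecondMoment hχ).fConv A.1
  have B := ((𝓕 φ).hasSecondMoment (φ.integral_norm_sq_fourier.trans hφ)).fConv
    ((𝓕 ψ).hasSecondMoment (ψ.integral_norm_sq_fourier.trans hψ))
  have B' := ((𝓕 χ).hasSecondMoment (χ.integral_norm_sq_fourier.trans hχ)).fConv B.1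
  have h1 := χ.dVar_mul_dVar_fourier_ge hχ
  have h2 := φ.dVar_mul_dVar_fourier_ge hφ
  have h3 := ψ.dVar_mul_dVar_fourier_ge hψ
  have a1 := dVar_norm_sq_nonneg χ
  have a2 := dVar_norm_sq_nonneg φ
  have a3 := dVar_norm_sq_nonneg ψ
  have b1 := dVar_norm_sq_nonneg (𝓕 χ : SchwartzMap ℝ ℂ)
  have b2 := dVar_norm_sq_nonneg (𝓕 φ : SchwartzMap ℝ ℂ)
  have b3 := dVar_norm_sq_nonneg (𝓕 ψ : SchwartzMap ℝ ℂ)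
  have h12 := two_mul_sq_le_mul_add_mul a1 b1 a2 b2 h1 h2
  have h13 := two_mul_sq_le_mul_add_mul a1 b1 a3 b3 h1 h3
  have h23 := two_mul_sq_le_mul_add_mul a2 b2 a3 b3 h2 h3
  rw [dStd, dStd, A'.2, A.2, B'.2, B.2, ← Real.sqrt_mul (by positivity)]
  apply Real.le_sqrt_of_sq_le
  rw [show 3 / (4 * Real.pi) = 3 * (1 / (4 * Real.pi)) by ring, mul_pow]
  linarith
end
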